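/- Let μ be a probability measure on ℝ with support contained in [−R, R] (R > 0). Let F and G be the cumulative distribution functions of the standard Gaussian γ_1 and of μ*γ_1 respectively. Then G⁻¹∘F is Lipschitz with ‖G⁻¹∘F‖_Lip ≤ max( exp(2R² + 2R + 1/8), e^{12R²} ). -/

import Mathlib

open MeasureTheory Real Filter

/-- The standard Gaussian density `p(t) = (2π)^{-1/2} exp(−t²/2)`. -/
noncomputable def stdp (t : ℝ) : ℝ := (2 * π) ^ (-(1 : ℝ) / 2) * Real.exp (-t ^ 2 / 2)

/-- `q(t) = ∫_{[−R,R]} p(t−s) dμ(s)`, the density of `μ ∗ γ₁`. -/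
noncomputable def qdens (μ : Measure ℝ) (R : ℝ) (t : ℝ) : ℝ :=
  ∫ s in Set.Icc (-R) R, stdp (t - s) ∂μ

/-- `Λ(x) = ∫_{[−R,R]} e^{xs} dμ(s)`. -/
noncomputable def Lam (μ : Measure ℝ) (R : ℝ) (x : ℝ) : ℝ :=
  ∫ s in Set.Icc (-R) R, Real.exp (x * s) ∂μ

/-- `K(x) = (log Λ(x) + R) / x`. -/
noncomputable def Kfun (μ : Measure ℝ) (R : ℝ) (x : ℝ) : ℝ :=
  (Real.log (Lam μ R x) + R) / x

/-- `F`, the cumulative distribution function of the standard Gaussian `γ₁`. -/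
noncomputable def Fcdf (x : ℝ) : ℝ := ∫ t in Set.Iic x, stdp t

/-- `G`, the cumulative distribution function of `μ ∗ γ₁`. -/
noncomputable def Gcdf (μ : Measure ℝ) (R : ℝ) (x : ℝ) : ℝ :=
  ∫ t in Set.Iic x, qdens μ R t

open scoped Topology

lemma stdp_eq (t : ℝ) : stdp t = ProbabilityTheory.gaussianPDFReal 0 1 t := by
  unfold stdp ProbabilityTheory.gaussianPDFReal
  have : (2 * π) ^ (-(1 : ℝ) / 2) = (√(2 * π))⁻¹ := by
    rw [Real.sqrt_eq_rpow, ← Real.rpow_neg (by positivity)]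
    norm_num
  rw [this]
  simp

lemma stdp_pos (t : ℝ) : 0 < stdp t := by unfold stdp; positivity

lemma stdp_continuous : Continuous stdp := by
  unfold stdp; fun_prop

lemma stdp_neg (t : ℝ) : stdp (-t) = stdp t := by simp [stdp]

lemma stdp_int : Integrable stdp := by
  have : stdp = ProbabilityTheory.gaussianPDFReal 0 1 := funext stdp_eq
  rw [this]; exact ProbabilityTheory.integrable_gaussianPDFReal 0 1

lemma stdp_integral : ∫ t, stdp t = 1 := by
  have : stdp = ProbabilityTheory.gaussianPDFReal 0 1 := funext stdp_eq
  rw [this]; exact ProbabilityTheory.integral_gaussianPDFReal_eq_one 0 one_ne_zero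

lemma stdp_int1 : Integrable (fun t => t * stdp t) := by
  have h := (integrable_mul_exp_neg_mul_sq (b := 1/2) (by norm_num)).const_mul
    ((2 * π) ^ (-(1 : ℝ) / 2))
  refine h.congr (Eventually.of_forall fun t => ?_)
  have e : -(1/2 : ℝ) * t ^ 2 = -t ^ 2 / 2 := by ring
  simp only [stdp, e]; ring

lemma stdp_int2 : Integrable (fun t => t ^ 2 * stdp t) := by
  have h := (integrable_rpow_mul_exp_neg_mul_sq (b := 1/2) (by norm_num)
    (s := 2) (by norm_num)).const_mul ((2 * π) ^ (-(1 : ℝ) / 2))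
  refine h.congr (Eventually.of_forall fun t => ?_)
  have e : -(1/2 : ℝ) * t ^ 2 = -t ^ 2 / 2 := by ring
  simp only [stdp, e, Real.rpow_two]; ring

lemma stdp_deriv (t : ℝ) : HasDerivAt stdp (-(t * stdp t)) t := by
  unfold stdp
  have h1 : HasDerivAt (fun t : ℝ => -t ^ 2 / 2) (-t) t := by
    have := ((hasDerivAt_pow 2 t).neg).div_const 2
    refine this.congr_deriv ?_
    norm_num
    ring
  have := (h1.exp).const_mul ((2 * π) ^ (-(1 : ℝ) / 2))
  refine this.congr_deriv ?_
  ring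

lemma cdf_strictDeriv {f : ℝ → ℝ} (hf : Continuous f) (hi : Integrable f) (x : ℝ) :
    HasStrictDerivAt (fun y => ∫ t in Set.Iic y, f t) (f x) x := by
  have h1 : (fun y => ∫ t in Set.Iic y, f t)
      = fun y => (∫ t in Set.Iic (0:ℝ), f t) + ∫ t in (0:ℝ)..y, f t := by
    funext y
    rw [← intervalIntegral.integral_Iic_sub_Iic hi.integrableOn hi.integrableOn]
    ring
  rw [h1]
  exact (intervalIntegral.integral_hasStrictDerivAt_right (hf.intervalIntegrable _ _)
    hf.stronglyMeasurable.stronglyMeasurableAtFilter hf.continuousAt).const_add _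

lemma F_deriv (x : ℝ) : HasDerivAt Fcdf (stdp x) x :=
  (cdf_strictDeriv stdp_continuous stdp_int x).hasDerivAt

lemma F_strictMono : StrictMono Fcdf :=
  strictMono_of_hasDerivAt_pos F_deriv stdp_pos

lemma F_continuous : Continuous Fcdf :=
  continuous_iff_continuousAt.2 fun x => (F_deriv x).continuousAt

lemma F_nonneg (x : ℝ) : 0 ≤ Fcdf x :=
  integral_nonneg fun t => (stdp_pos t).le

lemma F_pos (x : ℝ) : 0 < Fcdf x :=
  (F_nonneg (x - 1)).trans_lt (F_strictMono (by linarith))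

lemma F_neg (x : ℝ) : Fcdf (-x) = 1 - Fcdf x := by
  have h1 := integral_comp_neg_Iic (-x) stdp
  simp only [stdp_neg, neg_neg] at h1
  have h2 := intervalIntegral.integral_Iic_add_Ioi (μ := volume) (b := x)
    stdp_int.integrableOn stdp_int.integrableOn
  rw [stdp_integral] at h2
  unfold Fcdf
  linarith

lemma F_le_one (x : ℝ) : Fcdf x ≤ 1 := by
  have := F_nonneg (-x); rw [F_neg] at this; linarith

lemma millsA (z : ℝ) : -z * Fcdf z ≤ stdp z := by
  have hi : Integrable (fun t => -(t * stdp t)) := stdp_int1.neg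
  have h1 : ∫ t in Set.Iic z, -(t * stdp t) = stdp z - 0 :=
    integral_Iic_of_hasDerivAt_of_tendsto' (fun t _ => stdp_deriv t) hi.integrableOn
      (tendsto_zero_of_hasDerivAt_of_integrableOn_Iic (a := z) (fun t _ => stdp_deriv t)
        hi.integrableOn stdp_int.integrableOn)
  rw [sub_zero] at h1
  rw [← h1, Fcdf, ← integral_const_mul]
  refine setIntegral_mono_on (stdp_int.const_mul _).integrableOn hi.integrableOn
    measurableSet_Iic fun t ht => ?_
  have ht' : t ≤ z := ht
  nlinarith [stdp_pos t]

lemma millsB (z : ℝ) : stdp z ^ 2 ≤ -z * stdp z * Fcdf z + Fcdf z ^ 2 := by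
  have key : ∀ c : ℝ, 0 ≤ -(z - 2 * c) * stdp z + (1 + c ^ 2) * Fcdf z := by
    intro c
    have hd : ∀ t, HasDerivAt (fun t => -(t - 2 * c) * stdp t)
        ((t ^ 2 - 2 * c * t - 1) * stdp t) t := by
      intro t
      have := (((hasDerivAt_id t).sub_const (2 * c)).neg).mul (stdp_deriv t)
      refine this.congr_deriv ?_
      simp; ring
    have hi' : Integrable (fun t => (t ^ 2 - 2 * c * t - 1) * stdp t) := by
      have := (stdp_int2.sub (stdp_int1.const_mul (2 * c))).sub stdp_int
      refine this.congr (Eventually.of_forall fun t => ?_)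
      simp; ring
    have hi : Integrable (fun t => -(t - 2 * c) * stdp t) := by
      have := (stdp_int.const_mul (2 * c)).sub stdp_int1
      refine this.congr (Eventually.of_forall fun t => ?_)
      simp; ring
    have h1 : ∫ t in Set.Iic z, (t ^ 2 - 2 * c * t - 1) * stdp t
        = -(z - 2 * c) * stdp z - 0 :=
      integral_Iic_of_hasDerivAt_of_tendsto' (fun t _ => hd t) hi'.integrableOn
        (tendsto_zero_of_hasDerivAt_of_integrableOn_Iic (a := z) (fun t _ => hd t)
          hi'.integrableOn hi.integrableOn)
    rw [sub_zero] at h1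
    rw [← h1, Fcdf, ← integral_const_mul,
      ← integral_add hi'.integrableOn (stdp_int.const_mul _).integrableOn]
    refine integral_nonneg fun t => ?_
    have : (t ^ 2 - 2 * c * t - 1) * stdp t + (1 + c ^ 2) * stdp t = (t - c) ^ 2 * stdp t := by
      ring
    show 0 ≤ (t ^ 2 - 2 * c * t - 1) * stdp t + (1 + c ^ 2) * stdp t
    rw [this]
    exact mul_nonneg (sq_nonneg _) (stdp_pos t).le
  have hF := F_pos z
  have h := key (-(stdp z / Fcdf z))
  have h2 := mul_nonneg h hF.le
  have e : (-(z - 2 * -(stdp z / Fcdf z)) * stdp z + (1 + (-(stdp z / Fcdf z)) ^ 2) * Fcdf z)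
      * Fcdf z = -z * stdp z * Fcdf z + Fcdf z ^ 2 - stdp z ^ 2 := by
    field_simp; ring
  rw [e] at h2
  linarith

/-- polynomial inequality -/
lemma polyIneq {r : ℝ} (hr : 0 < r) (hr4 : r < 1/4) {d : ℝ} (hd : 1 + 16 * r ≤ 16 * r * d)
    {E : ℝ} (hE : 145/128 + 9/4 * r + 17/4 * r ^ 2 ≤ E) :
    (d + 2 * r) * (E * d) + 1 ≤ (E * d) ^ 2 := by
  have hd1 : 1 < d := by nlinarith
  set e := 145/128 + 9/4 * r + 17/4 * r ^ 2 with he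
  have hP : 256 * r ^ 2 ≤ e * ((e - 1) * (16 * r + 1) ^ 2 - 32 * r ^ 2 * (16 * r + 1)) := by
    rw [he]
    have h5 : 0 < r ^ 5 := by positivity
    have h6 : 0 < r ^ 6 := by positivity
    nlinarith [mul_nonneg hr.le (sq_nonneg (r - 1/10)), sq_nonneg (r ^ 2 - 1/100),
      mul_nonneg hr.le (sq_nonneg (r ^ 2 - 1/100)), sq_nonneg (r - 1/10),
      sq_nonneg (r * (r - 1/10)), mul_nonneg hr.le (sq_nonneg (r * (r - 1/10)))]
  -- set a = 16 r + 1
  have ha : 0 < 16 * r + 1 := by positivity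
  have hx : 1 ≤ 16 * r * (d - 1) := by linarith
  have hepos : 1 < e := by rw [he]; nlinarith [sq_nonneg r]
  -- d ≥ d0 = (16 r + 1)/(16 r)
  obtain ⟨w, hw⟩ : ∃ w, w = 1 / d := ⟨_, rfl⟩
  have hwd : w * d = 1 := by rw [hw]; field_simp
  have hw0 : 0 < w := by rw [hw]; positivity
  have hw1 : w * (16 * r + 1) ≤ 16 * r := by nlinarith
  have h2 : w ^ 2 ≤ e * (e - 1 - 2 * r * w) := by
    have h3 : (w * (16 * r + 1)) ^ 2 ≤ (16 * r) ^ 2 := by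
      apply pow_le_pow_left₀ (by positivity) hw1
    have h4 : 2 * r * (w * (16 * r + 1)) ≤ 2 * r * (16 * r) := by gcongr
    have h5 : (e * (2 * r * (w * (16 * r + 1)))) * (16 * r + 1)
        ≤ (e * (2 * r * (16 * r))) * (16 * r + 1) := by gcongr
    have h6 : w ^ 2 * (16 * r + 1) ^ 2 ≤ e * (e - 1 - 2 * r * w) * (16 * r + 1) ^ 2 := by
      nlinarith
    exact le_of_mul_le_mul_right h6 (by positivity)
  have h3 : w ^ 2 ≤ E * (E - 1 - 2 * r * w) := by
    have : 0 ≤ e - 1 - 2 * r * w := by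
      by_contra hc
      push Not at hc
      nlinarith [sq_nonneg w]
    calc w ^ 2 ≤ e * (e - 1 - 2 * r * w) := h2
      _ ≤ E * (E - 1 - 2 * r * w) := by
        apply mul_le_mul hE (by linarith) this (by linarith)
  have h4 := mul_le_mul_of_nonneg_right h3 (sq_nonneg d)
  have e1 : w ^ 2 * d ^ 2 = 1 := by rw [← mul_pow, hwd, one_pow]
  have e2 : E * (E - 1 - 2 * r * w) * d ^ 2 = E ^ 2 * d ^ 2 - E * d ^ 2 - 2 * r * E * d * (w * d) := by
    ring
  rw [e1, e2, hwd] at h4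
  nlinarith

lemma numIneq {R : ℝ} (hR : 0 < R) {d : ℝ} (h1 : 5 * R < d) (h2 : 1 + 16 * R < 16 * R * d) :
    ∃ E, E ≤ max (Real.exp (2 * R ^ 2 + 2 * R + 1 / 8)) (Real.exp (12 * R ^ 2)) ∧ 0 < E ∧
      (d + 2 * R) * (E * d) + 1 ≤ (E * d) ^ 2 := by
  rcases lt_or_ge R (1/4) with h | h
  · refine ⟨_, le_max_left _ _, Real.exp_pos _, polyIneq hR h h2.le ?_⟩
    have := Real.quadratic_le_exp_of_nonneg (x := 2 * R ^ 2 + 2 * R + 1 / 8) (by positivity)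
    have h3 : 0 < R ^ 3 := by positivity
    have h4 : 0 < R ^ 4 := by positivity
    nlinarith
  · refine ⟨_, le_max_right _ _, Real.exp_pos _, ?_⟩
    have h0 : (3/4 : ℝ) ≤ 12 * R ^ 2 := by nlinarith
    have := Real.quadratic_le_exp_of_nonneg (x := 12 * R ^ 2) (by positivity)
    have hE : 2 ≤ Real.exp (12 * R ^ 2) := by nlinarith
    set E := Real.exp (12 * R ^ 2)
    have hd : 5/4 < d := by linarith
    have hs : d + 2 * R ≤ 7/5 * d := by linarith
    have h3 : (d + 2 * R) * (E * d) ≤ 7/5 * d * (E * d) := by gcongr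
    have h4 : 1 ≤ d ^ 2 := by nlinarith
    have h5 : 1 ≤ E * (E - 7/5) := by nlinarith
    nlinarith [mul_le_mul h5 h4 zero_le_one (by linarith)]

section
variable (μ : Measure ℝ) [IsProbabilityMeasure μ] (R : ℝ)

lemma ae_mem (hsupp : μ (Set.Icc (-R) R)ᶜ = 0) : ∀ᵐ s ∂μ, s ∈ Set.Icc (-R) R := hsupp

lemma qdens_eq (hsupp : μ (Set.Icc (-R) R)ᶜ = 0) (t : ℝ) :
    qdens μ R t = ∫ s, stdp (t - s) ∂μ := by
  unfold qdens
  rw [Measure.restrict_eq_self_of_ae_mem (ae_mem μ R hsupp)]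

lemma stdp_le (t : ℝ) : stdp t ≤ stdp 0 := by
  unfold stdp
  refine mul_le_mul_of_nonneg_left (Real.exp_le_exp.2 ?_) (by positivity)
  nlinarith [sq_nonneg t]

lemma stdp_int_mu (t : ℝ) : Integrable (fun s => stdp (t - s)) μ := by
  refine Integrable.of_bound (C := stdp 0) ?_ (Eventually.of_forall fun s => ?_)
  · exact (stdp_continuous.comp (by fun_prop)).aestronglyMeasurable
  · rw [Real.norm_of_nonneg (stdp_pos _).le]; exact stdp_le _

lemma q_cont (hsupp : μ (Set.Icc (-R) R)ᶜ = 0) : Continuous (qdens μ R) := by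
  rw [funext (qdens_eq μ R hsupp)]
  refine continuous_of_dominated (bound := fun _ => stdp 0) (fun t => (stdp_int_mu μ t).1)
    (fun t => Eventually.of_forall fun s => ?_) (integrable_const _)
    (Eventually.of_forall fun s => stdp_continuous.comp (by fun_prop))
  rw [Real.norm_of_nonneg (stdp_pos _).le]; exact stdp_le _

lemma prod_int : Integrable (Function.uncurry fun (t s : ℝ) => stdp (t - s))
    ((volume : Measure ℝ).prod μ) := by
  have hc : Continuous (Function.uncurry fun (t s : ℝ) => stdp (t - s)) :=
    stdp_continuous.comp (by fun_prop)
  rw [integrable_prod_iff' hc.aestronglyMeasurable]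
  refine ⟨Eventually.of_forall fun s => stdp_int.comp_sub_right s, ?_⟩
  have : ∀ s : ℝ, ∫ t, ‖Function.uncurry (fun (t s : ℝ) => stdp (t - s)) (t, s)‖ = 1 := by
    intro s
    simp only [Function.uncurry, Real.norm_of_nonneg (stdp_pos _).le]
    rw [integral_sub_right_eq_self (fun t => stdp t) s, stdp_integral]
  simp only [this]
  exact integrable_const _

lemma q_int (hsupp : μ (Set.Icc (-R) R)ᶜ = 0) : Integrable (qdens μ R) := by
  rw [funext (qdens_eq μ R hsupp)]
  exact (prod_int μ).integral_prod_left

lemma shiftF (y s : ℝ) : ∫ t in Set.Iic y, stdp (t - s) = Fcdf (y - s) := by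
  have := (measurePreserving_sub_right (volume : Measure ℝ) s).setIntegral_preimage_emb
    (Homeomorph.subRight s).measurableEmbedding stdp (Set.Iic (y - s))
  rw [Fcdf, ← this]
  congr 2
  ext t
  simp

lemma G_eq (hsupp : μ (Set.Icc (-R) R)ᶜ = 0) (y : ℝ) :
    Gcdf μ R y = ∫ s, Fcdf (y - s) ∂μ := by
  unfold Gcdf
  simp only [qdens_eq μ R hsupp]
  rw [integral_integral_swap]
  · simp only [shiftF]
  · have : ((volume : Measure ℝ).restrict (Set.Iic y)).prod μ
      = ((volume : Measure ℝ).prod μ).restrict (Set.Iic y ×ˢ Set.univ) := by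
      rw [← Measure.prod_restrict, Measure.restrict_univ]
    rw [this]
    exact (prod_int μ).integrableOn

lemma F_int_mu (y : ℝ) : Integrable (fun s => Fcdf (y - s)) μ := by
  refine Integrable.of_bound (C := 1) ?_ (Eventually.of_forall fun s => ?_)
  · exact (F_continuous.comp (by fun_prop)).aestronglyMeasurable
  · rw [Real.norm_of_nonneg (F_nonneg _)]; exact F_le_one _

lemma G_bounds (hsupp : μ (Set.Icc (-R) R)ᶜ = 0) (y : ℝ) :
    Fcdf (y - R) ≤ Gcdf μ R y ∧ Gcdf μ R y ≤ Fcdf (y + R) := by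
  rw [G_eq μ R hsupp]
  have hc : ∀ c : ℝ, c = ∫ _, c ∂μ := fun c => by simp
  constructor
  · rw [hc (Fcdf (y - R))]
    refine integral_mono_ae (integrable_const _) (F_int_mu μ y) ?_
    filter_upwards [ae_mem μ R hsupp] with s hs
    exact F_strictMono.monotone (by linarith [hs.2])
  · rw [hc (Fcdf (y + R))]
    refine integral_mono_ae (F_int_mu μ y) (integrable_const _) ?_
    filter_upwards [ae_mem μ R hsupp] with s hs
    exact F_strictMono.monotone (by linarith [hs.1])

lemma q_lower (hsupp : μ (Set.Icc (-R) R)ᶜ = 0) (y : ℝ) :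
    stdp (|y| + R) ≤ qdens μ R y := by
  rw [qdens_eq μ R hsupp]
  have hc : ∀ c : ℝ, c = ∫ _, c ∂μ := fun c => by simp
  rw [hc (stdp (|y| + R))]
  refine integral_mono_ae (integrable_const _) (stdp_int_mu μ y) ?_
  filter_upwards [ae_mem μ R hsupp] with s hs
  have h1 : |y - s| ≤ |y| + R := (abs_sub _ _).trans (by gcongr; exact abs_le.2 hs)
  have h2 : (y - s) ^ 2 ≤ (|y| + R) ^ 2 := by
    rw [← sq_abs (y - s)]; gcongr
  simp only [stdp]
  gcongr

lemma q_tail_left (hsupp : μ (Set.Icc (-R) R)ᶜ = 0) (y : ℝ) :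
    (-y - R) * Gcdf μ R y ≤ qdens μ R y := by
  rw [qdens_eq μ R hsupp, G_eq μ R hsupp, ← integral_const_mul]
  refine integral_mono_ae ((F_int_mu μ y).const_mul _) (stdp_int_mu μ y) ?_
  filter_upwards [ae_mem μ R hsupp] with s hs
  have := millsA (y - s)
  nlinarith [F_pos (y - s), hs.1, hs.2]

lemma q_tail_right (hsupp : μ (Set.Icc (-R) R)ᶜ = 0) (y : ℝ) :
    (y - R) * (1 - Gcdf μ R y) ≤ qdens μ R y := by
  have : 1 - Gcdf μ R y = ∫ s, (1 - Fcdf (y - s)) ∂μ := by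
    rw [integral_sub (integrable_const _) (F_int_mu μ y), G_eq μ R hsupp]; simp
  rw [qdens_eq μ R hsupp, this, ← integral_const_mul]
  refine integral_mono_ae (((integrable_const _).sub (F_int_mu μ y)).const_mul _)
    (stdp_int_mu μ y) ?_
  filter_upwards [ae_mem μ R hsupp] with s hs
  have := millsA (-(y - s))
  rw [stdp_neg, F_neg] at this
  nlinarith [F_le_one (y - s), hs.1, hs.2]

end

/-- abstract tail step -/
lemma tailStep {P Q T x d R E : ℝ} (hP : 0 < P) (hT : 0 < T) (hd : 0 < d) (hE : 0 < E)
    (hR : 0 < R)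
    (hx : x ≤ d + 2 * R) (hB : P ^ 2 ≤ x * P * T + T ^ 2) (hq : d * T ≤ Q)
    (hnum : (d + 2 * R) * (E * d) + 1 ≤ (E * d) ^ 2) : P ≤ E * Q := by
  have h1 : P ≤ E * d * T := by
    by_contra hc
    push Not at hc
    set k := E * d with hk
    have hk0 : 0 < k := by positivity
    have hb : P ^ 2 ≤ (d + 2 * R) * P * T + T ^ 2 := by
      have : x * P * T ≤ (d + 2 * R) * P * T := by gcongr
      linarith
    -- P > kT ; P(P - (d+2R)T) ≤ T^2 , but P - (d+2R) T > (k - (d+2R)) T , k(k-(d+2R)) ≥ 1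
    have hk1 : 0 < k - (d + 2 * R) := by
      by_contra h
      push Not at h
      nlinarith
    have h3 : (k - (d + 2 * R)) * T < P - (d + 2 * R) * T := by linarith
    have h4 : (k * T) * ((k - (d + 2 * R)) * T) < P * (P - (d + 2 * R) * T) :=
      mul_lt_mul hc h3.le (by positivity) hP.le
    have h5 : T ^ 2 ≤ (k * T) * ((k - (d + 2 * R)) * T) := by
      have : (k * T) * ((k - (d + 2 * R)) * T) = (k ^ 2 - (d + 2 * R) * k) * T ^ 2 := by ring
      rw [this]
      nlinarith [sq_nonneg T]
    nlinarith
  calc P ≤ E * (d * T) := by linarith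
    _ ≤ E * Q := by gcongr

lemma main_bound (μ : Measure ℝ) [IsProbabilityMeasure μ] (R : ℝ) (hR : 0 < R)
    (hsupp : μ (Set.Icc (-R) R)ᶜ = 0) (x y : ℝ) (h : Gcdf μ R y = Fcdf x) :
    stdp x ≤ max (Real.exp (2 * R ^ 2 + 2 * R + 1 / 8)) (Real.exp (12 * R ^ 2)) * qdens μ R y := by
  obtain ⟨hb1, hb2⟩ := G_bounds μ R hsupp y
  rw [h] at hb1 hb2
  have hx1 : y - R ≤ x := F_strictMono.le_iff_le.1 hb1
  have hx2 : x ≤ y + R := F_strictMono.le_iff_le.1 hb2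
  have hqpos : 0 < qdens μ R y := (stdp_pos _).trans_le (q_lower μ R hsupp y)
  by_cases hc : 2 * R * |y| ≤ max (2 * R ^ 2 + 2 * R + 1 / 8) (12 * R ^ 2)
  · have hexp : ((|y| + R) ^ 2 - x ^ 2) / 2 ≤ max (2 * R ^ 2 + 2 * R + 1 / 8) (12 * R ^ 2) := by
      have hxa : |y| - R ≤ |x| := by
        have : |y - x| ≤ R := abs_le.2 ⟨by linarith, by linarith⟩
        have := abs_sub_abs_le_abs_sub y x
        linarith
      rcases le_total |y| R with hy | hy
      · refine le_trans ?_ (le_max_right _ _)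
        nlinarith [sq_nonneg x, abs_nonneg y]
      · refine le_trans ?_ hc
        have : (|y| - R) ^ 2 ≤ x ^ 2 := by
          rw [← sq_abs x]; exact pow_le_pow_left₀ (by linarith) hxa 2
        nlinarith
    have e1 : stdp x = Real.exp (((|y| + R) ^ 2 - x ^ 2) / 2) * stdp (|y| + R) := by
      simp only [stdp]
      rw [mul_left_comm, ← Real.exp_add]
      congr 2; ring
    rw [e1]
    have e2 : Real.exp (((|y| + R) ^ 2 - x ^ 2) / 2)
        ≤ max (Real.exp (2 * R ^ 2 + 2 * R + 1 / 8)) (Real.exp (12 * R ^ 2)) := by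
      rw [← Real.exp_monotone.map_max]
      exact Real.exp_le_exp.2 hexp
    exact mul_le_mul e2 (q_lower μ R hsupp y) (stdp_pos _).le ((Real.exp_pos _).le.trans e2)
  · push Not at hc
    obtain ⟨hc1, hc2⟩ := max_lt_iff.1 hc
    have h6 : 6 * R < |y| := by
      by_contra hh
      push Not at hh
      nlinarith
    obtain ⟨E, hE1, hE0, hE2⟩ := numIneq hR (d := |y| - R) (by linarith) (by nlinarith)
    refine le_trans ?_ (mul_le_mul_of_nonneg_right hE1 hqpos.le)
    rcases le_total 0 y with hy | hy
    · rw [abs_of_nonneg hy] at *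
      have hT : 0 < 1 - Fcdf x := by rw [← F_neg]; exact F_pos _
      have hB := millsB (-x)
      rw [stdp_neg, F_neg, neg_neg] at hB
      have hq := q_tail_right μ R hsupp y
      rw [h] at hq
      exact tailStep (stdp_pos x) hT (by linarith) hE0 hR (by linarith) hB hq hE2
    · rw [abs_of_nonpos hy] at *
      have hq := q_tail_left μ R hsupp y
      rw [h] at hq
      exact tailStep (stdp_pos x) (F_pos x) (by linarith) hE0 hR (by linarith) (millsB x) hq hE2

theorem stmt16 (μ : Measure ℝ) [IsProbabilityMeasure μ] (R : ℝ) (hR : 0 < R)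
    (hsupp : μ (Set.Icc (-R) R)ᶜ = 0)
    (H : ℝ → ℝ) (hH : ∀ x, Gcdf μ R (H x) = Fcdf x) :
    LipschitzWith
      (Real.toNNReal (max (Real.exp (2 * R ^ 2 + 2 * R + 1 / 8)) (Real.exp (12 * R ^ 2)))) H := by
  have hq : ∀ y, 0 < qdens μ R y := fun y => (stdp_pos _).trans_le (q_lower μ R hsupp y)
  have hG : ∀ y, HasStrictDerivAt (Gcdf μ R) (qdens μ R y) y := fun y =>
    cdf_strictDeriv (q_cont μ R hsupp) (q_int μ R hsupp) y
  have hGm : StrictMono (Gcdf μ R) := strictMono_of_hasDerivAt_pos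
    (fun y => (hG y).hasDerivAt) hq
  have hinv : ∀ y, Function.invFun (Gcdf μ R) (Gcdf μ R y) = y :=
    Function.leftInverse_invFun hGm.injective
  have hHe : H = fun x => Function.invFun (Gcdf μ R) (Fcdf x) := by
    funext x; rw [← hH, hinv]
  have hd : ∀ x, HasDerivAt H ((qdens μ R (H x))⁻¹ * stdp x) x := by
    intro x
    have h1 := ((hG (H x)).to_local_left_inverse (hq _).ne'
      (Eventually.of_forall hinv)).hasDerivAt
    rw [hH] at h1
    have h2 := h1.comp x (F_deriv x)
    have h3 : Function.invFun (Gcdf μ R) ∘ Fcdf = H := hHe.symm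
    rwa [h3] at h2
  refine lipschitzWith_of_nnnorm_deriv_le (fun x => (hd x).differentiableAt) fun x => ?_
  rw [(hd x).deriv, ← NNReal.coe_le_coe, coe_nnnorm,
    Real.coe_toNNReal _ ((Real.exp_pos _).le.trans (le_max_left _ _)),
    Real.norm_of_nonneg (mul_nonneg (inv_nonneg.2 (hq _).le) (stdp_pos x).le),
    inv_mul_le_iff₀ (hq _)]
  rw [mul_comm]
  exact main_bound μ R hR hsupp x (H x) (hH x)
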